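/- arXiv:2503.10826 — 4 statements merged into one kernel-verified Lean document; each statement's English description precedes it below -/
import Mathlib

section
/- Let a, b, k, m be positive integers with a, b ≥ 2 and gcd(a,b) = 1, and let S = ⟨Geom(a,b;k)⟩. If the gap set H(S) is equidistributed modulo m, then gcd(ab, m) = 1 and at least one of the following cases holds: (1) a ≡ 1 (mod m) or b ≡ 1 (mod m); (2) a ≡ b (mod m); (3) a ≢ b (mod m) and a^k ≡ b^k ≡ 1 (mod m); (4) a ≢ b (mod m) and a^{k+1} ≡ b^{k+1} ≡ 1 (mod m). -/
/-- The numerical semigroup generated by the geometric sequence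
`a^k, a^(k-1)*b, …, b^k`. -/
def geomNS (a b k : ℕ) : AddSubmonoid ℕ :=
  AddSubmonoid.closure ((fun i => a ^ (k - i) * b ^ i) '' Set.Iic k)

/-- A set of naturals is equidistributed modulo `m`: every residue class modulo `m`
contains the same number of elements of the set. -/
def EquidistMod (T : Set ℕ) (m : ℕ) : Prop :=
  ∀ r s : ZMod m,
    Nat.card {n : ℕ // n ∈ T ∧ (n : ZMod m) = r} =
      Nat.card {n : ℕ // n ∈ T ∧ (n : ZMod m) = s}

namespace ZMod

lemma one_sub_stdAddChar_ne_zero {m : ℕ} [NeZero m] {x : ZMod m} (hx : x ≠ 0) :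
    (1 - stdAddChar x : ℂ) ≠ 0 := fun h0 =>
  hx (injective_stdAddChar (by
    rw [AddChar.map_zero_eq_one]; exact (sub_eq_zero.1 h0).symm))

lemma multiset_eq_of_stdAddChar_sum_eq {m : ℕ} [NeZero m] {M N : Multiset (ZMod m)}
    (h : ∀ x : ZMod m, (M.map fun p => (stdAddChar (x * p) : ℂ)).sum =
      (N.map fun p => (stdAddChar (x * p) : ℂ)).sum) : M = N := by
  classical
  have key (M : Multiset (ZMod m)) (c : ZMod m) :
      ∑ x : ZMod m, stdAddChar (x * -c) *
        (M.map fun p => (stdAddChar (x * p) : ℂ)).sum = m * M.count c := by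
    induction M using Multiset.induction_on with
    | empty => simp
    | cons p M ih =>
      simp only [Multiset.map_cons, Multiset.sum_cons, mul_add, Finset.sum_add_distrib, ih,
        ← AddChar.map_add_eq_mul, Multiset.count_cons]
      simp only [← mul_add, AddChar.sum_mulShift _ (isPrimitive_stdAddChar m), ZMod.card,
        neg_add_eq_zero]
      push_cast
      split_ifs <;> ring
  ext c
  have e := key M c
  simp only [h, key N c] at e
  exact_mod_cast (mul_left_cancel₀ (Nat.cast_ne_zero.2 (NeZero.ne m)) e).symm

lemma add_eq_add_of_prod_one_sub_stdAddChar_eq {m : ℕ} [NeZero m] {p q r s t u : ZMod m}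
    (hp : IsUnit p) (hq : IsUnit q) (hr : IsUnit r)
    (h : ∀ x : ZMod m, x ≠ 0 →
      ((1 - stdAddChar (x * p)) * (1 - stdAddChar (x * q)) * (1 - stdAddChar (x * r)) : ℂ) =
      (1 - stdAddChar (x * s)) * (1 - stdAddChar (x * t)) * (1 - stdAddChar (x * u))) :
    p + q + r = s + t + u := by
  rcases subsingleton_or_nontrivial (ZMod m) with _ | _
  · exact Subsingleton.elim _ _
  apply injective_stdAddChar
  have hP := one_sub_stdAddChar_ne_zero hp.ne_zero
  have hQ := one_sub_stdAddChar_ne_zero hq.ne_zero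
  have hR := one_sub_stdAddChar_ne_zero hr.ne_zero
  have h1 := h 1 one_ne_zero
  have h2 := h (-1) (neg_ne_zero.2 one_ne_zero)
  simp only [one_mul, neg_mul, AddChar.map_neg_eq_inv] at h1 h2
  have hne (y : ZMod m) : (stdAddChar y : ℂ) ≠ 0 := (stdAddChar.val_isUnit y).ne_zero
  have hs := hne s
  have ht := hne t
  have hu := hne u
  have hp := hne p
  have hq := hne q
  have hr := hne r
  simp only [AddChar.map_add_eq_mul]
  generalize (stdAddChar p : ℂ) = P at *
  generalize (stdAddChar q : ℂ) = Q at *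
  generalize (stdAddChar r : ℂ) = R at *
  generalize (stdAddChar s : ℂ) = S at *
  generalize (stdAddChar t : ℂ) = T at *
  generalize (stdAddChar u : ℂ) = U at *
  field_simp at h2
  refine mul_left_cancel₀ (mul_ne_zero (mul_ne_zero hP hQ) hR) ?_
  linear_combination (P * Q * R) * h1 + h2

lemma pair_eq_pair_of_prod_one_sub_stdAddChar_eq {m : ℕ} [NeZero m] {p q r t u : ZMod m}
    (hp : IsUnit p) (hsum : q + r = t + u)
    (h : ∀ x : ZMod m, x ≠ 0 →
      ((1 - stdAddChar (x * p)) * ((1 - stdAddChar (x * q)) * (1 - stdAddChar (x * r))) : ℂ) =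
      (1 - stdAddChar (x * p)) * ((1 - stdAddChar (x * t)) * (1 - stdAddChar (x * u)))) :
    ({q, r} : Multiset (ZMod m)) = {t, u} := by
  apply multiset_eq_of_stdAddChar_sum_eq
  intro x
  simp only [Multiset.insert_eq_cons, Multiset.map_cons, Multiset.map_singleton,
    Multiset.sum_cons, Multiset.sum_singleton]
  by_cases hx : x = 0
  · simp [hx]
  have h1 := mul_left_cancel₀
    (one_sub_stdAddChar_ne_zero (fun h0 => hx ((hp.mul_left_eq_zero).1 h0))) (h x hx)
  have h2 : (stdAddChar (x * q) * stdAddChar (x * r) : ℂ) =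
      stdAddChar (x * t) * stdAddChar (x * u) := by
    rw [← AddChar.map_add_eq_mul, ← AddChar.map_add_eq_mul, ← mul_add, hsum, mul_add]
  linear_combination h2 - h1

/-- Triples of units whose cyclotomic products `∏ (1 - ζ ^ p)` agree at all nontrivial `m`-th roots
of unity are equal up to order, unless `m ∣ 2`. -/
lemma triple_eq_triple_of_prod_one_sub_stdAddChar_eq {m : ℕ} [NeZero m] {p q r s t u : ZMod m}
    (hp : IsUnit p) (hq : IsUnit q) (hr : IsUnit r)
    (h : ∀ x : ZMod m, x ≠ 0 →
      ((1 - stdAddChar (x * p)) * (1 - stdAddChar (x * q)) * (1 - stdAddChar (x * r)) : ℂ) =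
      (1 - stdAddChar (x * s)) * (1 - stdAddChar (x * t)) * (1 - stdAddChar (x * u))) :
    (2 : ZMod m) = 0 ∨ ({p, q, r} : Multiset (ZMod m)) = {s, t, u} := by
  rcases subsingleton_or_nontrivial (ZMod m) with _ | _
  · exact Or.inl (Subsingleton.elim _ _)
  have hsum := add_eq_add_of_prod_one_sub_stdAddChar_eq hp hq hr h
  have hM : ({p, q, r, s + t, s + u, t + u} : Multiset (ZMod m)) =
      {s, t, u, p + q, p + r, q + r} := by
    apply multiset_eq_of_stdAddChar_sum_eq
    intro x
    simp only [Multiset.insert_eq_cons, Multiset.map_cons, Multiset.map_singleton,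
      Multiset.sum_cons, Multiset.sum_singleton]
    by_cases hx : x = 0
    · simp [hx]
    have h1 := h x hx
    have h2 : (stdAddChar (x * p) * stdAddChar (x * q) * stdAddChar (x * r) : ℂ) =
        stdAddChar (x * s) * stdAddChar (x * t) * stdAddChar (x * u) := by
      simp only [← AddChar.map_add_eq_mul, ← mul_add, hsum]
    simp only [mul_add, AddChar.map_add_eq_mul]
    linear_combination -h1 - h2
  -- either one of `p`, `q` occurs among `s`, `t`, `u`, or `p = q + r` and `q = p + r`
  have hp' : p ∈ ({s, t, u, p + q, p + r, q + r} : Multiset (ZMod m)) := by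
    rw [← hM]
    simp
  have hq' : q ∈ ({s, t, u, p + q, p + r, q + r} : Multiset (ZMod m)) := by
    rw [← hM]
    simp
  simp only [Multiset.insert_eq_cons, Multiset.mem_cons, Multiset.mem_singleton, left_eq_add,
    right_eq_add, hp.ne_zero, hq.ne_zero, hr.ne_zero, false_or] at hp' hq'
  have pair {p q r s t u : ZMod m} (hp : IsUnit p) (hps : p = s) (hsum : p + q + r = s + t + u)
      (h : ∀ x : ZMod m, x ≠ 0 →
        ((1 - stdAddChar (x * p)) * (1 - stdAddChar (x * q)) * (1 - stdAddChar (x * r)) : ℂ) =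
        (1 - stdAddChar (x * s)) * (1 - stdAddChar (x * t)) * (1 - stdAddChar (x * u))) :
      ({p, q, r} : Multiset (ZMod m)) = {s, t, u} := by
    subst hps
    have := pair_eq_pair_of_prod_one_sub_stdAddChar_eq (q := q) (r := r) (t := t) (u := u) hp
      (by linear_combination hsum) (fun x hx => by linear_combination h x hx)
    rw [Multiset.insert_eq_cons, this, Multiset.insert_eq_cons p]
  have swap (x y z : ZMod m) : ({x, y, z} : Multiset (ZMod m)) = {y, x, z} :=
    Multiset.cons_swap x y _
  have rotate (x y z : ZMod m) : ({x, y, z} : Multiset (ZMod m)) = {z, x, y} := by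
    rw [swap z, Multiset.insert_eq_cons, Multiset.insert_eq_cons x, Multiset.pair_comm]
  have main {p q r : ZMod m} (hp : IsUnit p) (hsum : p + q + r = s + t + u)
      (h : ∀ x : ZMod m, x ≠ 0 →
        ((1 - stdAddChar (x * p)) * (1 - stdAddChar (x * q)) * (1 - stdAddChar (x * r)) : ℂ) =
        (1 - stdAddChar (x * s)) * (1 - stdAddChar (x * t)) * (1 - stdAddChar (x * u)))
      (hmem : p = s ∨ p = t ∨ p = u) : ({p, q, r} : Multiset (ZMod m)) = {s, t, u} := by
    rcases hmem with h1 | h1 | h1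
    · exact pair hp h1 hsum h
    · rw [swap s]
      exact pair hp h1 (by linear_combination hsum) (fun x hx => by linear_combination h x hx)
    · rw [rotate s]
      exact pair hp h1 (by linear_combination hsum) (fun x hx => by linear_combination h x hx)
  by_cases hpm : p = s ∨ p = t ∨ p = u
  · exact Or.inr (main hp hsum h hpm)
  by_cases hqm : q = s ∨ q = t ∨ q = u
  · right
    rw [swap p]
    exact main hq (by linear_combination hsum) (fun x hx => by linear_combination h x hx) hqm
  left
  have h1 : p = q + r := by tauto
  have h2 : q = p + r := by tauto
  have h3 : r * 2 = 0 := by linear_combination -h1 - h2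
  exact hr.mul_right_eq_zero.1 h3

end ZMod

open Polynomial in
/-- The difference of `∑ j < B, X ^ j` and `(1 - X ^ B) * ∑ n ∈ F, X ^ n`. When `F` is the gap set
of a numerical semigroup containing `B`, it is the generating polynomial of the Apéry set of `B`. -/
noncomputable def aperyPoly (F : Finset ℕ) (B : ℕ) : ℂ[X] :=
  ∑ j ∈ Finset.range B, X ^ j - (∑ n ∈ F, X ^ n) * (1 - X ^ B)

open Classical Polynomial in
lemma coeff_aperyPoly {S : AddSubmonoid ℕ} {F : Finset ℕ} (hF : ∀ n, n ∈ F ↔ n ∉ S) {B : ℕ}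
    (hB : B ∈ S) (n : ℕ) :
    (aperyPoly F B).coeff n = if n ∈ S ∧ ¬ (B ≤ n ∧ n - B ∈ S) then 1 else 0 := by
  have hadd : B ≤ n → n - B ∈ S → n ∈ S := fun h1 h2 => by
    have := S.add_mem h2 hB
    rwa [Nat.sub_add_cancel h1] at this
  simp only [aperyPoly, mul_sub, mul_one, coeff_sub, finsetSum_coeff, coeff_X_pow,
    coeff_mul_X_pow', Finset.sum_ite_eq, Finset.mem_range, hF]
  by_cases h1 : B ≤ n <;> by_cases h2 : n - B ∈ S <;> by_cases h3 : n ∈ S <;>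
    simp_all

open Polynomial in
lemma aperyPoly_eq_expand {S T : AddSubmonoid ℕ} {F G : Finset ℕ} (hF : ∀ n, n ∈ F ↔ n ∉ S)
    (hG : ∀ n, n ∈ G ↔ n ∉ T) {a B : ℕ} (ha : 0 < a) (haB : a.Coprime B) (hB : B ∈ T)
    (hST : ∀ n, n ∈ S ↔ ∃ t ∈ T, ∃ c, n = a * t + c * B) :
    aperyPoly F B = expand ℂ a (aperyPoly G B) := by
  classical
  have hBS : B ∈ S := (hST B).2 ⟨0, T.zero_mem, 1, by simp⟩
  ext n
  rw [coeff_expand ha, coeff_aperyPoly hF hBS, coeff_aperyPoly hG hB, ← ite_and]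
  congr 1
  rw [eq_iff_iff]
  constructor
  · rintro ⟨hn, hnB⟩
    obtain ⟨t, ht, c, rfl⟩ := (hST n).1 hn
    rcases c with _ | c
    · simp only [zero_mul, add_zero] at hn hnB ⊢
      rw [Nat.mul_div_cancel_left _ ha]
      refine ⟨Nat.dvd_mul_right _ _, ht, fun ⟨h1, h2⟩ => hnB ⟨by nlinarith, ?_⟩⟩
      refine (hST _).2 ⟨t - B, h2, a - 1, ?_⟩
      obtain ⟨s, rfl⟩ := Nat.exists_eq_add_of_le h1
      obtain ⟨a, rfl⟩ := Nat.exists_eq_add_of_le' ha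
      simp only [Nat.add_sub_cancel_left, Nat.add_sub_cancel]
      rw [Nat.sub_eq_iff_eq_add (by nlinarith)]
      ring
    · refine absurd ⟨by nlinarith, (hST _).2 ⟨t, ht, c, ?_⟩⟩ hnB
      rw [Nat.sub_eq_iff_eq_add (by nlinarith)]
      ring
  · rintro ⟨⟨t, rfl⟩, h⟩
    rw [Nat.mul_div_cancel_left _ ha] at h
    refine ⟨(hST _).2 ⟨t, h.1, 0, by simp⟩, fun ⟨h1, h2⟩ => h.2 ?_⟩
    obtain ⟨s, hs, c, hc⟩ := (hST _).1 h2
    rw [Nat.sub_eq_iff_eq_add h1] at hc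
    have hdvd : a ∣ (c + 1) * B := by
      rw [← Nat.dvd_add_right (Nat.dvd_mul_right a s)]
      exact ⟨t, by rw [hc]; ring⟩
    obtain ⟨j, hj⟩ := haB.dvd_of_dvd_mul_right hdvd
    obtain ⟨i, rfl⟩ : ∃ i, j = i + 1 := Nat.exists_eq_succ_of_ne_zero (by rintro rfl; simp at hj)
    have ht : t = s + i * B + B := by
      apply Nat.eq_of_mul_eq_mul_left ha
      calc a * t = a * s + (c + 1) * B := by rw [hc]; ring
        _ = _ := by rw [hj]; ring
    subst ht
    simp only [Nat.add_sub_cancel, le_add_iff_nonneg_left, zero_le, true_and]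
    exact T.add_mem hs (by simpa using T.nsmul_mem hB i)

lemma geomNS_comm (a b k : ℕ) : geomNS a b k = geomNS b a k := by
  unfold geomNS
  congr 1
  ext n
  constructor <;>
  · rintro ⟨i, hi, rfl⟩
    refine ⟨k - i, Nat.sub_le _ _, ?_⟩
    simp only [Nat.sub_sub_self (Set.mem_Iic.1 hi), mul_comm]

lemma finite_gaps_geomNS {a b : ℕ} (hab : a.Coprime b) (k : ℕ) :
    {n | n ∉ geomNS a b k}.Finite := by
  obtain ⟨N, hN⟩ := Nat.exists_mem_closure_of_ge ((fun i => a ^ (k - i) * b ^ i) '' Set.Iic k)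
  refine (Set.finite_Iio N).subset fun n hn => ?_
  by_contra hlt
  refine hn (hN n (by simpa using hlt) ?_)
  have h1 : Nat.setGcd ((fun i => a ^ (k - i) * b ^ i) '' Set.Iic k) ∣ a ^ k :=
    Nat.setGcd_dvd_of_mem ⟨0, by simp, by simp⟩
  have h2 : Nat.setGcd ((fun i => a ^ (k - i) * b ^ i) '' Set.Iic k) ∣ b ^ k :=
    Nat.setGcd_dvd_of_mem ⟨k, by simp, by simp⟩
  rw [Nat.eq_one_of_dvd_coprimes (hab.pow k k) h1 h2]
  exact one_dvd n

lemma pow_mem_geomNS (a b k : ℕ) : b ^ k ∈ geomNS a b k :=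
  AddSubmonoid.subset_closure ⟨k, by simp, by simp⟩

lemma mem_geomNS_succ {a b k n : ℕ} :
    n ∈ geomNS a b (k + 1) ↔ ∃ t ∈ geomNS a b k, ∃ c, n = a * t + c * b ^ (k + 1) := by
  constructor
  · intro h
    refine AddSubmonoid.closure_induction (motive := fun n _ =>
      ∃ t ∈ geomNS a b k, ∃ c, n = a * t + c * b ^ (k + 1)) ?_ ?_ ?_ h
    · rintro _ ⟨i, hi, rfl⟩
      rcases (Set.mem_Iic.1 hi).eq_or_lt with rfl | hlt
      · exact ⟨0, zero_mem _, 1, by simp⟩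
      · refine ⟨a ^ (k - i) * b ^ i, AddSubmonoid.subset_closure ⟨i, Nat.le_of_lt_succ hlt, rfl⟩,
          0, ?_⟩
        simp only [Nat.succ_sub (Nat.le_of_lt_succ hlt), pow_succ]
        ring
    · exact ⟨0, zero_mem _, 0, by simp⟩
    · rintro _ _ _ _ ⟨t, ht, c, rfl⟩ ⟨t', ht', c', rfl⟩
      exact ⟨t + t', add_mem ht ht', c + c', by ring⟩
  · rintro ⟨t, ht, c, rfl⟩
    refine add_mem ?_ ?_
    · refine AddSubmonoid.closure_induction (motive := fun n _ => a * n ∈ geomNS a b (k + 1))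
        ?_ ?_ ?_ ht
      · rintro _ ⟨i, hi, rfl⟩
        refine AddSubmonoid.subset_closure ⟨i, Nat.le_succ_of_le hi, ?_⟩
        simp only [Nat.succ_sub (Set.mem_Iic.1 hi), pow_succ]
        ring
      · simp
      · intro x y _ _ hx hy
        rw [mul_add]
        exact add_mem hx hy
    · rw [← smul_eq_mul]
      exact nsmul_mem (pow_mem_geomNS a b (k + 1)) c

lemma pow_succ_mem_geomNS (a b k : ℕ) : b ^ (k + 1) ∈ geomNS a b k := by
  rw [pow_succ', ← smul_eq_mul]
  exact nsmul_mem (pow_mem_geomNS a b k) b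

lemma EquidistMod.sum_eq_zero {F : Finset ℕ} {m : ℕ} [NeZero m] (h : EquidistMod (F : Set ℕ) m)
    {x : ZMod m} (hx : x ≠ 0) : ∑ n ∈ F, ZMod.stdAddChar x ^ n = 0 := by
  classical
  have hcard (r : ZMod m) : Nat.card {n : ℕ // n ∈ (F : Set ℕ) ∧ (n : ZMod m) = r} =
      (F.filter fun n : ℕ => (n : ZMod m) = r).card :=
    Nat.subtype_card _ (by simp)
  rw [← Finset.sum_fiberwise F (fun n : ℕ => (n : ZMod m))]
  have hfib (r : ZMod m) : ∑ n ∈ F with ((n : ℕ) : ZMod m) = r, ZMod.stdAddChar x ^ n =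
      ((F.filter fun n : ℕ => (n : ZMod m) = 0).card : ℂ) * ZMod.stdAddChar (r * x) := by
    rw [← hcard 0, h 0 r, hcard r, ← nsmul_eq_mul]
    refine Finset.sum_eq_card_nsmul fun n hn => ?_
    rw [← (Finset.mem_filter.1 hn).2, ← AddChar.map_nsmul_eq_pow, nsmul_eq_mul]
  rw [Finset.sum_congr rfl fun r _ => hfib r, ← Finset.mul_sum,
    AddChar.sum_mulShift x (ZMod.isPrimitive_stdAddChar m), if_neg hx]
  simp

/-- The functional equation linking two consecutive geometric semigroups, at a root of unity at
which the gap polynomial of the larger one vanishes. -/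
lemma sum_pow_eq_aperyPoly_eval {a b k : ℕ} (ha : 0 < a) (hab : a.Coprime b) {F G : Finset ℕ}
    (hF : ∀ n, n ∈ F ↔ n ∉ geomNS a b (k + 1)) (hG : ∀ n, n ∈ G ↔ n ∉ geomNS a b k) {z : ℂ}
    (hz : ∑ n ∈ F, z ^ n = 0) :
    ∑ j ∈ Finset.range (b ^ (k + 1)), z ^ j =
      ∑ j ∈ Finset.range (b ^ (k + 1)), (z ^ a) ^ j -
        (∑ n ∈ G, (z ^ a) ^ n) * (1 - (z ^ a) ^ b ^ (k + 1)) := by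
  have h := congrArg (Polynomial.eval z) (aperyPoly_eq_expand hF hG ha (hab.pow_right (k + 1))
    (pow_succ_mem_geomNS a b k) fun n => mem_geomNS_succ)
  simpa [aperyPoly, Polynomial.expand_eval, Polynomial.eval_finsetSum, hz] using h

lemma isUnit_of_equidistMod {a b k m : ℕ} [NeZero m] (ha : 0 < a) (hb : 2 ≤ b) (hab : a.Coprime b)
    {F : Finset ℕ} (hF : ∀ n, n ∈ F ↔ n ∉ geomNS a b (k + 1))
    (h : EquidistMod (F : Set ℕ) m) : IsUnit (a : ZMod m) := by
  classical
  have hG := finite_gaps_geomNS hab k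
  have key (x : ZMod m) (hx : x ≠ 0) (hax : (a : ZMod m) * x = 0) :
      1 - ZMod.stdAddChar (((b ^ (k + 1) : ℕ) : ZMod m) * x) =
        ((b ^ (k + 1) : ℕ) : ℂ) * (1 - ZMod.stdAddChar x) := by
    have hz : ZMod.stdAddChar x ^ a = (1 : ℂ) := by
      rw [← AddChar.map_nsmul_eq_pow, nsmul_eq_mul, hax, AddChar.map_zero_eq_one]
    have e := sum_pow_eq_aperyPoly_eval ha hab hF (G := hG.toFinset) (by simp) (h.sum_eq_zero hx)
    rw [hz] at e
    rw [← nsmul_eq_mul, AddChar.map_nsmul_eq_pow, ← geom_sum_mul_neg, e]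
    simp
  have hinj : ∀ x : ZMod m, (a : ZMod m) * x = 0 → x = 0 := by
    by_contra! hcon
    obtain ⟨x, hx, hmax⟩ := (Finset.univ.filter fun x : ZMod m => (a : ZMod m) * x = 0 ∧
      x ≠ 0).exists_max_image (fun x => ‖(1 - ZMod.stdAddChar x : ℂ)‖)
      (by obtain ⟨x, h1, h2⟩ := hcon; exact ⟨x, by simp [h1, h2]⟩)
    simp only [Finset.mem_filter, Finset.mem_univ, true_and] at hx hmax
    have hk := key x hx.2 hx.1
    have hB : (1 : ℝ) < (b ^ (k + 1) : ℕ) := by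
      exact_mod_cast Nat.one_lt_pow (Nat.succ_ne_zero k) hb
    have hpos : 0 < ‖(1 - ZMod.stdAddChar x : ℂ)‖ :=
      norm_pos_iff.2 (ZMod.one_sub_stdAddChar_ne_zero hx.2)
    have hnorm := congrArg norm hk
    rw [norm_mul, Complex.norm_natCast] at hnorm
    have hle := hmax (((b ^ (k + 1) : ℕ) : ZMod m) * x)
      ⟨by rw [mul_left_comm, hx.1, mul_zero], fun h0 => by
        rw [h0, AddChar.map_zero_eq_one, sub_self, norm_zero] at hnorm
        nlinarith⟩
    nlinarith
  obtain ⟨y, hy⟩ := Finite.surjective_of_injective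
    ((injective_iff_map_eq_zero (AddMonoidHom.mulLeft (a : ZMod m))).2 hinj) 1
  exact IsUnit.of_mul_eq_one y hy


open ZMod in
lemma three_term_relation {a b k m : ℕ} [NeZero m] (ha : 0 < a) (hb : 0 < b) (hab : a.Coprime b)
    (hau : IsUnit (a : ZMod m)) (hbu : IsUnit (b : ZMod m)) {F : Finset ℕ}
    (hF : ∀ n, n ∈ F ↔ n ∉ geomNS a b (k + 1)) (h : EquidistMod (F : Set ℕ) m) {x : ZMod m}
    (hx : x ≠ 0) :
    ((1 - stdAddChar (x * (b : ZMod m))) * (1 - stdAddChar (x * (a * b ^ (k + 2) : ZMod m))) *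
      (1 - stdAddChar (x * (a ^ (k + 2) : ZMod m))) : ℂ) =
    (1 - stdAddChar (x * (a : ZMod m))) * (1 - stdAddChar (x * (b * a ^ (k + 2) : ZMod m))) *
      (1 - stdAddChar (x * (b ^ (k + 2) : ZMod m))) := by
  have hG := finite_gaps_geomNS hab k
  have hne {y : ZMod m} (hy : IsUnit y) : (1 - stdAddChar (x * y) : ℂ) ≠ 0 :=
    one_sub_stdAddChar_ne_zero fun h0 => hx ((hy.mul_left_eq_zero).1 h0)
  have h1 := sum_pow_eq_aperyPoly_eval ha hab hF (G := hG.toFinset) (by simp)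
    (h.sum_eq_zero (x := x * b) fun h0 => hx ((hbu.mul_left_eq_zero).1 h0))
  have h2 := sum_pow_eq_aperyPoly_eval hb hab.symm (k := k) (by simpa [geomNS_comm b a] using hF)
    (G := hG.toFinset) (by simp [geomNS_comm b a])
    (h.sum_eq_zero (x := x * a) fun h0 => hx ((hau.mul_left_eq_zero).1 h0))
  have hpow (y : ZMod m) (n : ℕ) : (stdAddChar y : ℂ) ^ n = stdAddChar (y * (n : ZMod m)) := by
    rw [← AddChar.map_nsmul_eq_pow, nsmul_eq_mul, mul_comm]
  have hab' : x * a * b = x * b * a := by ring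
  rw [hpow _ b, hab'] at h2
  rw [hpow _ a] at h1
  have hz := hne (hbu.mul hau)
  rw [← mul_assoc] at hz
  have e1 := geom_sum_mul_neg (stdAddChar (x * (b : ZMod m)) : ℂ) (b ^ (k + 1))
  have e2 := geom_sum_mul_neg (stdAddChar (x * (a : ZMod m)) : ℂ) (a ^ (k + 1))
  have e3 := geom_sum_mul_neg (stdAddChar (x * (b : ZMod m) * (a : ZMod m)) : ℂ) (b ^ (k + 1))
  have e4 := geom_sum_mul_neg (stdAddChar (x * (b : ZMod m) * (a : ZMod m)) : ℂ) (a ^ (k + 1))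
  rw [h1] at e1
  rw [h2] at e2
  rw [show (x * (b * a ^ (k + 2)) : ZMod m) = x * b * a * (a ^ (k + 1) : ℕ) by push_cast; ring,
    show (x * (a * b ^ (k + 2)) : ZMod m) = x * b * a * (b ^ (k + 1) : ℕ) by push_cast; ring,
    show (x * a ^ (k + 2) : ZMod m) = x * a * (a ^ (k + 1) : ℕ) by push_cast; ring,
    show (x * b ^ (k + 2) : ZMod m) = x * b * (b ^ (k + 1) : ℕ) by push_cast; ring]
  simp only [← hpow _ (a ^ (k + 1)), ← hpow _ (b ^ (k + 1))]
  refine mul_left_cancel₀ hz ?_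
  generalize (stdAddChar (x * (b : ZMod m) * (a : ZMod m)) : ℂ) = z at *
  generalize (stdAddChar (x * (b : ZMod m)) : ℂ) = v at *
  generalize (stdAddChar (x * (a : ZMod m)) : ℂ) = u at *
  linear_combination (1 - u) * (1 - z ^ a ^ (k + 1)) * (1 - z) * e1 -
    (1 - v) * (1 - z ^ b ^ (k + 1)) * (1 - z) * e2 -
    (1 - u) * (1 - v) * (1 - z ^ a ^ (k + 1)) * e3 +
    (1 - u) * (1 - v) * (1 - z ^ b ^ (k + 1)) * e4

/-- An equality of triples of products of powers leaves only the listed possibilities. -/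
lemma one_or_eq_or_pow_eq_one_of_triple_eq {R : Type*} [CommRing R] {x y : R} (hx : IsUnit x)
    (hy : IsUnit y) {n : ℕ}
    (h : ({y, x * y ^ (n + 1), x ^ (n + 1)} : Multiset R) = {x, y * x ^ (n + 1), y ^ (n + 1)}) :
    (x = 1 ∨ y = 1) ∨ x = y ∨ (x ≠ y ∧ x ^ n = 1 ∧ y ^ n = 1) ∨
      (x ≠ y ∧ x ^ (n + 1) = 1 ∧ y ^ (n + 1) = 1) := by
  by_cases hxy : x = y
  · exact Or.inr (Or.inl hxy)
  have hmem : y ∈ ({x, y * x ^ (n + 1), y ^ (n + 1)} : Multiset R) := by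
    rw [← h]
    simp
  simp only [Multiset.insert_eq_cons, Multiset.mem_cons, Multiset.mem_singleton] at hmem
  rcases hmem with h1 | h1 | h1
  · exact absurd h1.symm hxy
  · have hxn : x ^ (n + 1) = 1 := hy.mul_left_cancel (by rw [mul_one, ← h1])
    have hone : (1 : R) ∈ ({x, y * x ^ (n + 1), y ^ (n + 1)} : Multiset R) := by
      rw [← h, hxn]
      simp
    simp only [Multiset.insert_eq_cons, Multiset.mem_cons, Multiset.mem_singleton, hxn,
      mul_one] at hone
    rcases hone with h2 | h2 | h2
    · exact Or.inl (Or.inl h2.symm)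
    · exact Or.inl (Or.inr h2.symm)
    · exact Or.inr (Or.inr (Or.inr ⟨hxy, hxn, h2.symm⟩))
  · have hyn : y ^ n = 1 := hy.mul_left_cancel (by rw [mul_one, ← pow_succ', ← h1])
    have hmem : x ∈ ({y, x * y ^ (n + 1), x ^ (n + 1)} : Multiset R) := by
      rw [h]
      simp
    simp only [Multiset.insert_eq_cons, Multiset.mem_cons, Multiset.mem_singleton, ← h1] at hmem
    rcases hmem with h2 | h2 | h2
    · exact absurd h2 hxy
    · exact Or.inl (Or.inr (hx.mul_left_cancel (by rw [mul_one, ← h2])))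
    · refine Or.inr (Or.inr (Or.inl ⟨hxy, hx.mul_left_cancel ?_, hyn⟩))
      rw [mul_one, ← pow_succ', ← h2]

theorem stmt_12 (a b k m : ℕ) (ha : 2 ≤ a) (hb : 2 ≤ b) (hk : 0 < k) (hm : 0 < m)
    (hab : Nat.Coprime a b)
    (h : EquidistMod {n : ℕ | n ∉ geomNS a b k} m) :
    Nat.Coprime (a * b) m ∧
      (((a : ZMod m) = 1 ∨ (b : ZMod m) = 1) ∨
        (a : ZMod m) = (b : ZMod m) ∨
        ((a : ZMod m) ≠ (b : ZMod m) ∧ (a : ZMod m) ^ k = 1 ∧ (b : ZMod m) ^ k = 1) ∨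
        ((a : ZMod m) ≠ (b : ZMod m) ∧
          (a : ZMod m) ^ (k + 1) = 1 ∧ (b : ZMod m) ^ (k + 1) = 1)) := by
  have : NeZero m := ⟨hm.ne'⟩
  obtain ⟨k, rfl⟩ := Nat.exists_eq_add_of_le' hk
  have hfin := finite_gaps_geomNS hab (k + 1)
  have hF (n : ℕ) : n ∈ hfin.toFinset ↔ n ∉ geomNS a b (k + 1) := by simp
  rw [← hfin.coe_toFinset] at h
  have hau := isUnit_of_equidistMod (by lia) hb hab hF h
  have hbu := isUnit_of_equidistMod (k := k) (by lia) ha hab.symm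
    (by simpa only [geomNS_comm b a] using hF) h
  refine ⟨Nat.Coprime.mul_left ((ZMod.isUnit_iff_coprime a m).1 hau)
    ((ZMod.isUnit_iff_coprime b m).1 hbu), ?_⟩
  rcases ZMod.triple_eq_triple_of_prod_one_sub_stdAddChar_eq hbu (hau.mul (hbu.pow (k + 2)))
    (hau.pow (k + 2)) fun x hx => three_term_relation (by lia) (by lia) hab hau hbu hF h hx
    with h2 | h3
  · left
    left
    have hm2 : m ∣ 2 := (ZMod.natCast_eq_zero_iff 2 m).1 (by exact_mod_cast h2)
    rcases (Nat.dvd_prime Nat.prime_two).1 hm2 with rfl | rfl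
    · exact Subsingleton.elim _ _
    · generalize (a : ZMod 2) = y at hau
      revert y
      decide
  exact one_or_eq_or_pow_eq_one_of_triple_eq hau hbu h3
end

section
/- Let a, k, m be positive integers with gcd(a, m) = 1. Then C_m(X) = 1 + X + ⋯ + X^{m−1} divides (X − 1)·(X^{a^{k+1}} − 1)^k − (X^{a^k} − 1)^{k+1} in ℤ[X] if and only if one of the following holds: a ≡ 1 (mod m); or a ≡ −1 (mod m), k is even, and m divides k; or a ≡ −1 (mod m), k is odd, and m divides k + 1. -/
open Polynomial

theorem pow_eq_pow_of_natCast_zmod_eq {M : Type*} [Monoid M] {x : M} {m i j : ℕ}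
    (hx : x ^ m = 1) (h : (i : ZMod m) = (j : ZMod m)) : x ^ i = x ^ j := by
  rw [ZMod.natCast_eq_natCast_iff'] at h
  rw [pow_eq_pow_mod i hx, pow_eq_pow_mod j hx, h]

theorem sub_one_pow_eq_of_mul_eq_one {R : Type*} [CommRing R] {x y : R} {n : ℕ}
    (hxy : x * y = 1) (hn : Even n) : (y - 1) ^ n = y ^ n * (x - 1) ^ n := by
  have h : y - 1 = -(y * (x - 1)) := by linear_combination hxy
  rw [h, hn.neg_pow, mul_pow]

theorem sub_one_mul_pow_eq_of_zmod {R : Type*} [CommRing R] {x : R} {a k m : ℕ}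
    (hx : x ^ m = 1)
    (h : (a : ZMod m) = 1 ∨
        ((a : ZMod m) = -1 ∧ Even k ∧ m ∣ k) ∨
        ((a : ZMod m) = -1 ∧ Odd k ∧ m ∣ (k + 1))) :
    (x - 1) * (x ^ (a ^ (k + 1)) - 1) ^ k = (x ^ (a ^ k) - 1) ^ (k + 1) := by
  have key : ∀ {n d : ℕ}, (a : ZMod m) = -1 → Odd n → m ∣ d → Even d →
      (x ^ (a ^ n) - 1) ^ d = (x - 1) ^ d := by
    intro n d ha hn hd hd'
    have hxy : x * x ^ (a ^ n) = 1 := by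
      rw [← pow_succ', ← pow_zero x]
      exact pow_eq_pow_of_natCast_zmod_eq hx (by push_cast; rw [ha, hn.neg_one_pow]; simp)
    obtain ⟨c, rfl⟩ := hd
    rw [sub_one_pow_eq_of_mul_eq_one hxy hd', ← pow_mul, mul_left_comm, pow_mul, hx, one_pow,
      one_mul]
  have fix : ∀ {n : ℕ}, (a : ZMod m) ^ n = 1 → x ^ (a ^ n) = x := by
    intro n hn
    conv_rhs => rw [← pow_one x]
    exact pow_eq_pow_of_natCast_zmod_eq hx (by push_cast; exact hn)
  rcases h with ha | ⟨ha, hk, hd⟩ | ⟨ha, hk, hd⟩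
  · rw [fix (by simp [ha]), fix (by simp [ha]), pow_succ']
  · rw [key ha hk.add_one hd hk, fix (by rw [ha, hk.neg_one_pow]), pow_succ']
  · rw [key ha hk hd hk.add_one, fix (by rw [ha, hk.add_one.neg_one_pow]), pow_succ']

theorem Complex.eq_or_mul_eq_one_of_norm_sub_one_eq {z w : ℂ} (hz : ‖z‖ = 1) (hw : ‖w‖ = 1)
    (h : ‖z - 1‖ = ‖w - 1‖) : w = z ∨ w * z = 1 := by
  have sq : ∀ u : ℂ, ‖u‖ ^ 2 = u.re ^ 2 + u.im ^ 2 := by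
    intro u
    rw [← Complex.normSq_eq_norm_sq, Complex.normSq_apply]
    ring
  have h1 := sq z
  have h2 := sq w
  have h3 := sq (z - 1)
  rw [h, sq (w - 1)] at h3
  rw [hz] at h1
  rw [hw] at h2
  simp only [Complex.sub_re, Complex.sub_im, Complex.one_re, Complex.one_im, sub_zero] at h3
  have hre : w.re = z.re := by linarith
  have him : w.im ^ 2 = z.im ^ 2 := by rw [hre] at h2; linarith
  rcases sq_eq_sq_iff_eq_or_eq_neg.mp him with h4 | h4
  · exact Or.inl (Complex.ext hre h4)
  · right
    apply Complex.ext
    · simp only [Complex.mul_re, hre, h4, Complex.one_re]; linarith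
    · simp only [Complex.mul_im, hre, h4, Complex.one_im]; ring

theorem eq_of_periodic_of_mul_pow_eq {h : ℕ → ℝ} {p k : ℕ} (hp : 0 < p) (hk : 0 < k)
    (hpos : ∀ n, 0 < h n) (hper : Function.Periodic h p)
    (hrec : ∀ n, h n * h (n + k + 1) ^ k = h (n + k) ^ (k + 1)) : h 0 = h 1 := by
  obtain ⟨N, -, hN⟩ := Finset.exists_max_image (Finset.range p) h ⟨0, by simpa using hp⟩
  have hmax : ∀ n, h n ≤ h N := by
    intro n
    rw [← hper.map_mod_nat n]
    exact hN _ (Finset.mem_range.mpr (Nat.mod_lt _ hp))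
  have step : ∀ n, h (n + k) = h N → h (n + k + 1) = h N := by
    intro n hn
    refine le_antisymm (hmax _) (le_of_pow_le_pow_left₀ hk.ne' (hpos _).le ?_)
    have h1 := hrec n
    rw [hn, pow_succ'] at h1
    have h2 := mul_le_mul_of_nonneg_right (hmax n) (pow_nonneg (hpos (n + k + 1)).le k)
    rw [h1] at h2
    exact le_of_mul_le_mul_left h2 (hpos N)
  have shift : ∀ n c, h (n + c * p) = h n := fun n c => by
    simpa using hper.nat_mul c n
  have hkp : k ≤ k * p := Nat.le_mul_of_pos_right k hp
  have all : ∀ j, h (N + k * p + j) = h N := by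
    intro j
    induction j with
    | zero => exact shift N k
    | succ j ih =>
      have e : N + k * p + j = (N + k * p + j - k) + k := by omega
      rw [← add_assoc, e]
      exact step _ (e ▸ ih)
  have const : ∀ n, h n = h N := by
    intro n
    have hNp : N ≤ N * p := Nat.le_mul_of_pos_right N hp
    rw [← shift n (N + k), ← all (n + (N * p - N))]
    congr 1
    rw [add_mul]
    omega
  rw [const 0, const 1]

theorem zmod_of_sub_one_mul_pow_eq {ζ : ℂ} {a k m : ℕ} (hk : 0 < k) (hm : 1 < m)
    (ham : Nat.Coprime a m) (hζ : IsPrimitiveRoot ζ m)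
    (hrec : ∀ x : ℂ, x ^ m = 1 → x ≠ 1 →
      (x - 1) * (x ^ (a ^ (k + 1)) - 1) ^ k = (x ^ (a ^ k) - 1) ^ (k + 1)) :
    (a : ZMod m) = 1 ∨
        ((a : ZMod m) = -1 ∧ Even k ∧ m ∣ k) ∨
        ((a : ZMod m) = -1 ∧ Odd k ∧ m ∣ (k + 1)) := by
  have hm0 : m ≠ 0 := by omega
  have hprim : ∀ n, IsPrimitiveRoot (ζ ^ (a ^ n)) m := fun n =>
    hζ.pow_of_coprime _ (ham.pow_left n)
  have hnorm : ‖ζ - 1‖ = ‖ζ ^ a - 1‖ := by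
    have := eq_of_periodic_of_mul_pow_eq (h := fun n => ‖ζ ^ (a ^ n) - 1‖)
      (Nat.totient_pos.mpr (by omega : 0 < m)) hk
      (fun n => norm_pos_iff.mpr (sub_ne_zero.mpr ((hprim n).ne_one hm)))
      (fun n => by
        have : ζ ^ (a ^ (n + m.totient)) = ζ ^ (a ^ n) := by
          refine pow_eq_pow_of_natCast_zmod_eq hζ.pow_eq_one ?_
          rw [ZMod.natCast_eq_natCast_iff, pow_add]
          simpa using (Nat.ModEq.pow_totient ham).mul_left (a ^ n)
        simp only [this])
      (fun n => by
        have := congrArg norm (hrec _ (hprim n).pow_eq_one ((hprim n).ne_one hm))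
        simpa only [norm_mul, norm_pow, ← pow_mul, ← pow_add, ← add_assoc] using this)
    simpa using this
  have hζ1 : ζ - 1 ≠ 0 := sub_ne_zero.mpr (hζ.ne_one hm)
  have dvd : ∀ {n d : ℕ}, ζ * ζ ^ (a ^ n) = 1 → Even d →
      (ζ ^ (a ^ n) - 1) ^ d = (ζ - 1) ^ d → m ∣ d := by
    intro n d hxy hd h
    rw [sub_one_pow_eq_of_mul_eq_one hxy hd] at h
    exact (hprim n).dvd_of_pow_eq_one d (mul_eq_right₀ (pow_ne_zero d hζ1) |>.mp h)
  have hzk := hrec ζ hζ.pow_eq_one (hζ.ne_one hm)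
  rcases Complex.eq_or_mul_eq_one_of_norm_sub_one_eq (hζ.norm'_eq_one hm0)
    ((by simpa using hprim 1 : IsPrimitiveRoot (ζ ^ a) m).norm'_eq_one hm0) hnorm with h | h
  · left
    have h2 : a % m = 1 := hζ.pow_inj (Nat.mod_lt _ (by omega)) hm (by
      rw [← pow_eq_pow_mod a hζ.pow_eq_one, h, pow_one])
    rw [← ZMod.natCast_mod, h2, Nat.cast_one]
  · right
    have ha : (a : ZMod m) = -1 := by
      rw [← pow_succ] at h
      have h2 := (ZMod.natCast_eq_zero_iff _ _).mpr (hζ.dvd_of_pow_eq_one _ h)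
      push_cast at h2
      exact eq_neg_of_add_eq_zero_left h2
    have inv : ∀ {n : ℕ}, Odd n → ζ * ζ ^ (a ^ n) = 1 := by
      intro n hn
      rw [← pow_succ', ← pow_zero ζ]
      exact pow_eq_pow_of_natCast_zmod_eq hζ.pow_eq_one
        (by push_cast; rw [ha, hn.neg_one_pow]; simp)
    have fix : ∀ {n : ℕ}, Even n → ζ ^ (a ^ n) = ζ := by
      intro n hn
      conv_rhs => rw [← pow_one ζ]
      exact pow_eq_pow_of_natCast_zmod_eq hζ.pow_eq_one
        (by push_cast; rw [ha, hn.neg_one_pow])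
    rcases Nat.even_or_odd k with hk' | hk'
    · rw [fix hk', pow_succ' (ζ - 1)] at hzk
      exact Or.inl ⟨ha, hk', dvd (inv hk'.add_one) hk' (mul_left_cancel₀ hζ1 hzk)⟩
    · rw [fix hk'.add_one, ← pow_succ'] at hzk
      exact Or.inr ⟨ha, hk', dvd (inv hk') hk'.add_one hzk.symm⟩

theorem stmt_13 (a k m : ℕ) (ha : 0 < a) (hk : 0 < k) (hm : 0 < m)
    (ham : Nat.Coprime a m) :
    (∑ i ∈ Finset.range m, (X : ℤ[X]) ^ i) ∣
        ((X - 1) * ((X : ℤ[X]) ^ (a ^ (k + 1)) - 1) ^ k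
          - ((X : ℤ[X]) ^ (a ^ k) - 1) ^ (k + 1)) ↔
      ((a : ZMod m) = 1 ∨
        ((a : ZMod m) = -1 ∧ Even k ∧ m ∣ k) ∨
        ((a : ZMod m) = -1 ∧ Odd k ∧ m ∣ (k + 1))) := by
  constructor
  · intro h
    obtain rfl | hm1 := (Nat.succ_le_of_lt hm).eq_or_lt
    · exact Or.inl (Subsingleton.elim _ _)
    refine zmod_of_sub_one_mul_pow_eq hk hm1 ham (Complex.isPrimitiveRoot_exp m hm.ne') ?_
    intro x hx hx1
    have hsum : ∑ i ∈ Finset.range m, x ^ i = 0 := by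
      rw [geom_sum_eq hx1, hx, sub_self, zero_div]
    have h2 := map_dvd (aeval x) h
    simp only [map_sum, map_sub, map_mul, map_pow, aeval_X, map_one, hsum, zero_dvd_iff] at h2
    exact sub_eq_zero.mp h2
  · intro h
    set C : ℤ[X] := ∑ i ∈ Finset.range m, (X : ℤ[X]) ^ i with hC
    rw [← Ideal.mem_span_singleton, ← Ideal.Quotient.eq_zero_iff_mem]
    have hx : (Ideal.Quotient.mk (Ideal.span {C}) X) ^ m = 1 := by
      rw [← sub_eq_zero, ← map_pow, ← map_one (Ideal.Quotient.mk (Ideal.span {C})), ← map_sub,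
        Ideal.Quotient.eq_zero_iff_mem, Ideal.mem_span_singleton, hC]
      exact ⟨X - 1, (geom_sum_mul X m).symm⟩
    simpa only [map_sub, map_mul, map_pow, map_one, sub_eq_zero] using
      sub_one_mul_pow_eq_of_zmod hx h
end

section
/- Let a, r, k, m be positive integers with gcd(a, m) = gcd(r, m) = 1, a^{k+1} ≡ 1 (mod m), r^{k+1} ≡ 1 (mod m), and r ≢ 1 (mod m). Then C_m(X) = 1 + X + ⋯ + X^{m−1} divides ∏_{i=0}^{k} (X^{a·r^i} − 1) − ∏_{i=0}^{k} (X^{r^i} − 1) in ℤ[X] if and only if one of the following holds: a is congruent modulo m to a power of r (i.e., ∃ i, a ≡ r^i (mod m)); or −a is congruent modulo m to a power of r, k is odd, and m divides 1 + r + r² + ⋯ + r^{k}. -/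
open Polynomial

lemma hasSum_pow_succ_mul_sub {z S : ℂ} {c : ℕ → ℂ} (hc : c 0 = 0)
    (h : HasSum (fun n ↦ z ^ n * c n) S) :
    HasSum (fun n ↦ z ^ (n + 1) * (c (n + 1) - c n)) ((1 - z) * S) := by
  have h1 : HasSum (fun n ↦ z ^ (n + 1) * c (n + 1)) S := by
    simpa [hc] using (hasSum_nat_add_iff' 1).mpr h
  have h2 : HasSum (fun n ↦ z ^ (n + 1) * c (n + 1) - z * (z ^ n * c n)) (S - z * S) :=
    h1.sub (h.mul_left z)
  rw [sub_mul, one_mul]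
  exact h2.congr_fun fun n ↦ by ring

lemma one_sub_mem_slitPlane {z : ℂ} (hz : ‖z‖ = 1) (hz1 : z ≠ 1) :
    1 - z ∈ Complex.slitPlane := by
  left
  rw [Complex.sub_re, Complex.one_re, sub_pos]
  refine lt_of_le_of_ne (hz ▸ Complex.re_le_norm z) fun h ↦ hz1 ?_
  have hsq := Complex.normSq_apply z
  rw [Complex.normSq_eq_norm_sq, hz, h] at hsq
  refine Complex.ext h ?_
  rw [Complex.one_im]
  nlinarith

lemma abs_rpow_neg_succ_sub_le (n : ℕ) {s : ℝ} (hs1 : 1 ≤ s) (hs2 : s ≤ 2) :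
    |((n + 1 : ℕ) : ℝ) ^ (-s) - (n : ℝ) ^ (-s)| ≤ 8 / ((n : ℝ) + 1) ^ 2 := by
  rcases Nat.eq_zero_or_pos n with rfl | hn
  · rw [Nat.cast_zero, Real.zero_rpow (by linarith)]
    norm_num
  have hn' : (1 : ℝ) ≤ n := by exact_mod_cast hn
  have hn0 : (0 : ℝ) < n := by linarith
  have hle : ((n + 1 : ℕ) : ℝ) ^ (-s) ≤ (n : ℝ) ^ (-s) :=
    Real.rpow_le_rpow_of_nonpos hn0 (by push_cast; linarith) (by linarith)
  have hsplit : ((n + 1 : ℕ) : ℝ) ^ (-s) = (n : ℝ) ^ (-s) * (1 + 1 / (n : ℝ)) ^ (-s) := by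
    rw [← Real.mul_rpow hn0.le (by positivity)]
    congr 1
    push_cast
    field_simp
  have h1 : (n : ℝ) ^ (-s) ≤ 1 / n := by
    calc (n : ℝ) ^ (-s) ≤ (n : ℝ) ^ (-1 : ℝ) :=
          Real.rpow_le_rpow_of_exponent_le hn' (by linarith)
      _ = 1 / n := by rw [Real.rpow_neg_one, one_div]
  have h2 : 1 - 2 / (n : ℝ) ≤ (1 + 1 / (n : ℝ)) ^ (-s) := by
    calc 1 - 2 / (n : ℝ) ≤ ((1 + 1 / (n : ℝ)) ^ 2)⁻¹ := by
          rw [← one_div, le_div_iff₀ (by positivity)]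
          have : (0 : ℝ) ≤ (1 / n) ^ 2 := by positivity
          have h' : (0 : ℝ) ≤ (1 / n) ^ 3 := by positivity
          rw [show 2 / (n : ℝ) = 2 * (1 / n) by ring]
          nlinarith
      _ = (1 + 1 / (n : ℝ)) ^ (-2 : ℝ) := by
          rw [Real.rpow_neg (by positivity)]; norm_num
      _ ≤ _ := Real.rpow_le_rpow_of_exponent_le (by simp) (by linarith)
  have h3 : 0 ≤ 1 - (1 + 1 / (n : ℝ)) ^ (-s) := by
    have := Real.rpow_le_one_of_one_le_of_nonpos (x := 1 + 1 / (n : ℝ)) (z := -s) (by simp) (by linarith)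
    linarith
  rw [abs_sub_comm, abs_of_nonneg (by linarith), hsplit]
  calc (n : ℝ) ^ (-s) - (n : ℝ) ^ (-s) * (1 + 1 / (n : ℝ)) ^ (-s)
      = (n : ℝ) ^ (-s) * (1 - (1 + 1 / (n : ℝ)) ^ (-s)) := by ring
    _ ≤ 1 / n * (2 / n) := by gcongr; linarith
    _ ≤ _ := by
      rw [div_mul_div_comm, div_le_div_iff₀ (by positivity) (by positivity)]
      nlinarith

lemma summable_eight_div : Summable (fun n : ℕ ↦ 8 / ((n : ℝ) + 1) ^ 2) := by
  have := ((summable_nat_add_iff 1).mpr (Real.summable_one_div_nat_pow.mpr one_lt_two)).mul_left 8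
  simpa [div_eq_mul_inv] using this

open Filter Topology HurwitzZeta in
lemma expZeta_one (a : ℝ) (ha : Complex.exp (2 * Real.pi * Complex.I * a) ≠ 1) :
    expZeta a 1 = -Complex.log (1 - Complex.exp (2 * Real.pi * Complex.I * a)) := by
  set z := Complex.exp (2 * Real.pi * Complex.I * a) with hz
  have hznorm : ‖z‖ = 1 := by
    rw [hz, show 2 * Real.pi * Complex.I * a = ((2 * Real.pi * a : ℝ) : ℂ) * Complex.I by
      push_cast; ring, Complex.norm_exp_ofReal_mul_I]
  have ha0 : (a : UnitAddCircle) ≠ 0 := by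
    intro h
    obtain ⟨n, hn⟩ := (AddCircle.coe_eq_zero_iff (1 : ℝ)).mp h
    apply ha
    rw [Complex.exp_eq_one_iff]
    refine ⟨n, ?_⟩
    rw [← hn]
    push_cast
    simp
    ring
  let c : ℝ → ℕ → ℂ := fun s n ↦ (((n : ℝ) ^ (-s) : ℝ) : ℂ)
  have hc0 (s : ℝ) (hs : 1 ≤ s) : c s 0 = 0 := by
    simp only [c, Nat.cast_zero]
    rw [Real.zero_rpow (by linarith), Complex.ofReal_zero]
  have hcb (s : ℝ) (h1 : 1 ≤ s) (h2 : s ≤ 2) (n : ℕ) (w : ℂ) (hw : ‖w‖ ≤ 1) :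
      ‖w ^ (n + 1) * (c s (n + 1) - c s n)‖ ≤ 8 / ((n : ℝ) + 1) ^ 2 := by
    rw [norm_mul, norm_pow]
    simp only [c]
    rw [← Complex.ofReal_sub, Complex.norm_real, Real.norm_eq_abs]
    exact (mul_le_of_le_one_left (abs_nonneg _) (pow_le_one₀ (norm_nonneg _) hw)).trans
      (abs_rpow_neg_succ_sub_le n h1 h2)
  have key1 : Tendsto (fun s : ℝ ↦ ∑' n, z ^ (n + 1) * (c s (n + 1) - c s n)) (𝓝[>] 1)
      (𝓝 (∑' n, z ^ (n + 1) * (c 1 (n + 1) - c 1 n))) := by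
    refine tendsto_tsum_of_dominated_convergence summable_eight_div (fun n ↦ ?_) ?_
    · have hcont (n : ℕ) : Tendsto (fun s ↦ c s n) (𝓝[>] 1) (𝓝 (c 1 n)) := by
        refine Tendsto.mono_left ?_ nhdsWithin_le_nhds
        refine (Complex.continuous_ofReal.tendsto _).comp ?_
        exact (Real.continuousAt_const_rpow' (by norm_num)).tendsto.comp
          (continuous_neg.tendsto (1 : ℝ))
      exact ((hcont _).sub (hcont _)).const_mul _
    · have : ∀ᶠ s : ℝ in 𝓝[>] 1, s ∈ Set.Ioo (1 : ℝ) 2 := Ioo_mem_nhdsGT one_lt_two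
      filter_upwards [this] with s hs n using hcb s hs.1.le hs.2.le n z hznorm.le
  have key2 : Tendsto (fun x : ℝ ↦ ∑' n, (z * x) ^ (n + 1) * (c 1 (n + 1) - c 1 n)) (𝓝[<] 1)
      (𝓝 (∑' n, z ^ (n + 1) * (c 1 (n + 1) - c 1 n))) := by
    refine tendsto_tsum_of_dominated_convergence summable_eight_div (fun n ↦ ?_) ?_
    · refine Tendsto.mul_const _ (Tendsto.mono_left ?_ nhdsWithin_le_nhds)
      have : Continuous (fun x : ℝ ↦ (z * x) ^ (n + 1)) := by fun_prop
      simpa using this.tendsto 1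
    · have : ∀ᶠ x : ℝ in 𝓝[<] 1, x ∈ Set.Ioo (0 : ℝ) 1 := Ioo_mem_nhdsLT one_pos
      filter_upwards [this] with x hx n
      refine hcb 1 le_rfl one_le_two n _ ?_
      rw [norm_mul, hznorm, one_mul, Complex.norm_real, Real.norm_eq_abs, abs_of_pos hx.1]
      exact hx.2.le
  have lim1 : Tendsto (fun s : ℝ ↦ ∑' n, z ^ (n + 1) * (c s (n + 1) - c s n)) (𝓝[>] 1)
      (𝓝 ((1 - z) * expZeta a 1)) := by
    have hcont : Tendsto (fun s : ℝ ↦ (1 - z) * expZeta a (s : ℂ)) (𝓝[>] 1)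
        (𝓝 ((1 - z) * expZeta a 1)) := by
      refine Tendsto.const_mul _ (Tendsto.mono_left ?_ nhdsWithin_le_nhds)
      have := ((differentiable_expZeta_of_ne_zero ha0).continuous.comp
        Complex.continuous_ofReal).tendsto 1
      simpa [Function.comp_def] using this
    refine hcont.congr' ?_
    filter_upwards [self_mem_nhdsWithin] with s (hs : 1 < s)
    refine (HasSum.tsum_eq ?_).symm
    refine hasSum_pow_succ_mul_sub (hc0 s hs.le) ?_
    convert hasSum_expZeta_of_one_lt_re a (s := s) (by simpa using hs) using 2 with n
    rw [hz, ← Complex.exp_nat_mul, div_eq_mul_inv]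
    congr 1
    · congr 1; ring
    · simp only [c]
      rw [Real.rpow_neg (Nat.cast_nonneg n), Complex.ofReal_inv,
        Complex.ofReal_cpow (Nat.cast_nonneg n), Complex.ofReal_natCast]
  have lim2 : Tendsto (fun x : ℝ ↦ ∑' n, (z * x) ^ (n + 1) * (c 1 (n + 1) - c 1 n)) (𝓝[<] 1)
      (𝓝 ((1 - z) * -Complex.log (1 - z))) := by
    have hslit : 1 - z ∈ Complex.slitPlane := one_sub_mem_slitPlane hznorm ha
    have hcont : Tendsto (fun x : ℝ ↦ (1 - z * x) * -Complex.log (1 - z * x)) (𝓝[<] 1)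
        (𝓝 ((1 - z) * -Complex.log (1 - z))) := by
      have h1 : Tendsto (fun x : ℝ ↦ 1 - z * x) (𝓝[<] 1) (𝓝 (1 - z)) := by
        refine Tendsto.mono_left ?_ nhdsWithin_le_nhds
        have : Continuous (fun x : ℝ ↦ 1 - z * x) := by fun_prop
        simpa using this.tendsto 1
      exact h1.mul (h1.clog hslit).neg
    refine hcont.congr' ?_
    have : ∀ᶠ x : ℝ in 𝓝[<] 1, x ∈ Set.Ioo (0 : ℝ) 1 := Ioo_mem_nhdsLT one_pos
    filter_upwards [this] with x hx
    refine (HasSum.tsum_eq ?_).symm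
    refine hasSum_pow_succ_mul_sub (hc0 1 le_rfl) ?_
    convert Complex.hasSum_taylorSeries_neg_log (z := z * x) ?_ using 2 with n
    · simp only [c]
      rw [Real.rpow_neg_one, Complex.ofReal_inv, Complex.ofReal_natCast, div_eq_mul_inv]
    · rw [norm_mul, hznorm, one_mul, Complex.norm_real, Real.norm_eq_abs, abs_of_pos hx.1]
      exact hx.2
  have e1 := tendsto_nhds_unique key1 lim1
  have e2 := tendsto_nhds_unique key2 lim2
  exact mul_left_cancel₀ (sub_ne_zero.mpr (Ne.symm ha)) (e1.symm.trans e2)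

lemma norm_stdAddChar {N : ℕ} [NeZero N] (j : ZMod N) : ‖ZMod.stdAddChar j‖ = 1 := by
  rw [ZMod.stdAddChar_apply, Circle.norm_coe]

lemma stdAddChar_ne_one {N : ℕ} [NeZero N] {j : ZMod N} (hj : j ≠ 0) :
    ZMod.stdAddChar j ≠ 1 := fun h ↦
  hj (ZMod.injective_stdAddChar (h.trans (AddChar.map_zero_eq_one _).symm))

lemma expZeta_toAddCircle_one {N : ℕ} [NeZero N] {j : ZMod N} (hj : j ≠ 0) :
    HurwitzZeta.expZeta (ZMod.toAddCircle j) 1 = -Complex.log (1 - ZMod.stdAddChar j) := by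
  have hexp : Complex.exp (2 * Real.pi * Complex.I * ((j.val / N : ℝ) : ℂ)) =
      ZMod.stdAddChar j := by
    have := ZMod.stdAddChar_coe (N := N) (j.val : ℤ)
    rw [Int.cast_natCast, ZMod.natCast_zmod_val] at this
    rw [this]
    push_cast
    congr 1
    ring
  rw [ZMod.toAddCircle_apply, expZeta_one _ (hexp ▸ stdAddChar_ne_one hj), hexp]

lemma log_one_sub_stdAddChar_add {N : ℕ} [NeZero N] {j : ZMod N} (hj : j ≠ 0) :
    Complex.log (1 - ZMod.stdAddChar j) + Complex.log (1 - ZMod.stdAddChar (-j)) =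
      2 * (Real.log ‖1 - ZMod.stdAddChar j‖ : ℂ) := by
  have hconj : 1 - ZMod.stdAddChar (-j) = starRingEnd ℂ (1 - ZMod.stdAddChar j) := by
    rw [map_sub, map_one, AddChar.map_neg_eq_inv, Complex.inv_def, Complex.normSq_eq_norm_sq,
      norm_stdAddChar]
    simp
  rw [hconj, Complex.log_conj _ (Complex.slitPlane_arg_ne_pi
    (one_sub_mem_slitPlane (norm_stdAddChar j) (stdAddChar_ne_one hj))), Complex.add_conj,
    Complex.log_re]
  push_cast
  rfl

lemma sum_mul_log_norm_one_sub_stdAddChar_ne_zero {N : ℕ} [NeZero N]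
    {χ : DirichletCharacter ℂ N} (hχ : χ.IsPrimitive) (h1 : χ ≠ 1) (he : χ.Even) :
    ∑ j, χ j * (Real.log ‖1 - ZMod.stdAddChar j‖ : ℂ) ≠ 0 := by
  have hN : N ≠ 1 := fun h ↦ h1 (DirichletCharacter.level_one' χ h)
  have h0 : χ 0 = 0 := χ.map_zero' hN
  have hL : DirichletCharacter.LFunction χ⁻¹ 1 ≠ 0 :=
    DirichletCharacter.LFunction_apply_one_ne_zero (inv_ne_one.mpr h1)
  have hdft : ZMod.dft χ = fun k ↦ gaussSum χ ZMod.stdAddChar * χ⁻¹ k := by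
    ext k
    rw [hχ.fourierTransform_eq_inv_mul_gaussSum, mul_comm, MulChar.inv_apply_eq_inv',
      MulChar.inv_apply_eq_inv', he.eval_neg]
  have hg : gaussSum χ ZMod.stdAddChar ≠ 0 := by
    intro hg
    have : (χ : ZMod N → ℂ) = 0 := by
      rw [← map_eq_zero_iff ZMod.dft ZMod.dft.injective, hdft, hg]
      ext; simp
    simpa using congrFun this 1
  have hsum : ∑ j, χ j * HurwitzZeta.expZeta (ZMod.toAddCircle (-j)) 1 ≠ 0 := by
    rw [← ZMod.LFunction_dft _ (Or.inl h0), hdft]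
    have : ZMod.LFunction (fun k ↦ gaussSum χ ZMod.stdAddChar * χ⁻¹ k) 1 =
        gaussSum χ ZMod.stdAddChar * DirichletCharacter.LFunction χ⁻¹ 1 := by
      simp only [DirichletCharacter.LFunction, ZMod.LFunction, mul_assoc, ← Finset.mul_sum]
      ring
    rw [this]
    exact mul_ne_zero hg hL
  have hneg : ∑ j, χ j * HurwitzZeta.expZeta (ZMod.toAddCircle (-j)) 1 =
      ∑ j, χ j * HurwitzZeta.expZeta (ZMod.toAddCircle j) 1 := by
    rw [← Equiv.sum_comp (Equiv.neg (ZMod N))]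
    simp [he.eval_neg]
  intro hzero
  apply hsum
  have h2 : 2 * ∑ j, χ j * HurwitzZeta.expZeta (ZMod.toAddCircle (-j)) 1 =
      -2 * ∑ j, χ j * (Real.log ‖1 - ZMod.stdAddChar j‖ : ℂ) := by
    rw [two_mul]
    nth_rewrite 1 [hneg]
    rw [← Finset.sum_add_distrib, Finset.mul_sum]
    refine Finset.sum_congr rfl fun j _ ↦ ?_
    rcases eq_or_ne j 0 with rfl | hj
    · simp [h0]
    · rw [expZeta_toAddCircle_one hj, expZeta_toAddCircle_one (neg_ne_zero.mpr hj)]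
      linear_combination -χ j * log_one_sub_stdAddChar_add hj
  rw [hzero, mul_zero] at h2
  simpa using h2

lemma mul_sum_mulChar_mul_comp {R : Type*} [CommRing R] [Fintype R] (ψ : MulChar R ℂ) {u : R}
    (hu : IsUnit u) (F : R → ℂ) : ψ u * ∑ j, ψ j * F (u * j) = ∑ j, ψ j * F j := by
  obtain ⟨u, rfl⟩ := hu
  rw [← Equiv.sum_comp (Units.mulLeft u) (fun j ↦ ψ j * F j), Finset.mul_sum]
  refine Finset.sum_congr rfl fun j _ ↦ ?_
  simp [mul_assoc]

lemma dirichletCharacter_apply_eq_one_of_prod_eq {m a r n : ℕ} [NeZero m] (hn : n ≠ 0)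
    (ham : Nat.Coprime a m) (hrm : Nat.Coprime r m)
    (h : ∀ z : ℂ, z ^ m = 1 → z ≠ 1 →
      ∏ i ∈ Finset.range n, (z ^ (a * r ^ i) - 1) = ∏ i ∈ Finset.range n, (z ^ r ^ i - 1))
    {χ : DirichletCharacter ℂ m} (hr : χ r = 1) (he : χ.Even) : χ a = 1 := by
  by_contra ha
  have : NeZero χ.conductor := ⟨χ.conductor_ne_zero⟩
  set f := χ.conductor with hf
  have hfm : f ∣ m := χ.conductor_dvd_level
  set ψ : DirichletCharacter ℂ f := χ.primitiveCharacter with hψ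
  have hψnat {b : ℕ} (hb : Nat.Coprime b m) : ψ b = χ b := by
    simpa using χ.primitiveCharacter_apply_of_isCoprime (a := b) (Nat.isCoprime_iff_coprime.mpr hb)
  have hψe : ψ.Even := by
    have := χ.primitiveCharacter_apply_of_isCoprime (a := -1) (isCoprime_one_left.neg_left)
    have he' : χ (-1) = 1 := he
    simpa [DirichletCharacter.Even, he'] using this
  have hau : IsUnit (a : ZMod f) := (ZMod.isUnit_iff_coprime a f).mpr (ham.coprime_dvd_right hfm)
  have hru : IsUnit (r : ZMod f) := (ZMod.isUnit_iff_coprime r f).mpr (hrm.coprime_dvd_right hfm)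
  have hψ1 : ψ ≠ 1 := by
    intro h1
    rw [← hψnat ham, h1, MulChar.one_apply hau] at ha
    exact ha rfl
  let L : ZMod f → ℂ := fun j ↦ (Real.log ‖1 - ZMod.stdAddChar j‖ : ℂ)
  have hS : ∑ j, ψ j * L j ≠ 0 :=
    sum_mul_log_norm_one_sub_stdAddChar_ne_zero χ.primitiveCharacter_isPrimitive hψ1 hψe
  have hL (j : ZMod f) (hj : j ≠ 0) :
      ∑ i ∈ Finset.range n, L ((a * r ^ i : ZMod f) * j) =
        ∑ i ∈ Finset.range n, L ((r ^ i : ZMod f) * j) := by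
    have hpow (b : ℕ) : ZMod.stdAddChar j ^ b = ZMod.stdAddChar ((b : ZMod f) * j) := by
      rw [← AddChar.map_nsmul_eq_pow, nsmul_eq_mul]
    have hz := h (ZMod.stdAddChar j) (by
      rw [hpow, (ZMod.natCast_eq_zero_iff m f).mpr hfm, zero_mul, AddChar.map_zero_eq_one])
      (stdAddChar_ne_one hj)
    simp only [hpow, Nat.cast_mul, Nat.cast_pow] at hz
    have hz' := congrArg (fun w ↦ Real.log ‖w‖) hz
    simp only [norm_prod] at hz'
    have hne {u : ZMod f} (hu : IsUnit u) : ‖ZMod.stdAddChar (u * j) - 1‖ ≠ 0 :=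
      norm_ne_zero_iff.mpr (sub_ne_zero.mpr (stdAddChar_ne_one
        (by rwa [ne_eq, hu.mul_right_eq_zero])))
    rw [Real.log_prod (fun i _ ↦ hne (hau.mul (hru.pow i))),
      Real.log_prod (fun i _ ↦ hne (hru.pow i))] at hz'
    simp only [L, norm_sub_rev (1 : ℂ)]
    exact_mod_cast hz'
  have hrψ : ψ r = 1 := (hψnat hrm).trans hr
  have hsum : ∑ i ∈ Finset.range n, ∑ j, ψ j * L ((a * r ^ i : ZMod f) * j) =
      ∑ i ∈ Finset.range n, ∑ j, ψ j * L ((r ^ i : ZMod f) * j) := by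
    rw [Finset.sum_comm, Finset.sum_comm (s := Finset.range n)]
    refine Finset.sum_congr rfl fun j _ ↦ ?_
    rw [← Finset.mul_sum, ← Finset.mul_sum]
    rcases eq_or_ne j 0 with rfl | hj
    · simp only [mul_zero]
    · rw [hL j hj]
  have h1 (i : ℕ) : ∑ j, ψ j * L ((r ^ i : ZMod f) * j) = ∑ j, ψ j * L j := by
    simpa [hrψ] using mul_sum_mulChar_mul_comp ψ (hru.pow i) L
  have h2 (i : ℕ) : ψ a * ∑ j, ψ j * L ((a * r ^ i : ZMod f) * j) = ∑ j, ψ j * L j := by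
    simpa [hrψ] using mul_sum_mulChar_mul_comp ψ (hau.mul (hru.pow i)) L
  have h3 := congrArg (ψ a * ·) hsum
  simp only [Finset.mul_sum (Finset.range n), h1, h2, Finset.sum_const, Finset.card_range,
    nsmul_eq_mul] at h3
  have hn' : (n : ℂ) ≠ 0 := Nat.cast_ne_zero.mpr hn
  apply ha
  rw [← hψnat ham]
  have h4 : (ψ a - 1) * ((n : ℂ) * ∑ j, ψ j * L j) = 0 := by linear_combination -h3
  rcases mul_eq_zero.mp h4 with h5 | h5
  · exact sub_eq_zero.mp h5
  · exact absurd h5 (mul_ne_zero hn' hS)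

lemma ZMod.exists_eq_pow_or_neg_eq_pow {m : ℕ} [NeZero m] {a r : ZMod m} (ha : IsUnit a)
    (hr : IsUnit r) (h : ∀ χ : DirichletCharacter ℂ m, χ r = 1 → χ.Even → χ a = 1) :
    (∃ i : ℕ, a = r ^ i) ∨ ∃ i : ℕ, -a = r ^ i := by
  obtain ⟨u, rfl⟩ := ha
  obtain ⟨v, rfl⟩ := hr
  let H : Subgroup (ZMod m)ˣ := Subgroup.closure {v, -1}
  have hu : u ∈ H := by
    rw [← QuotientGroup.eq_one_iff]
    by_contra hne
    have : NeZero (Monoid.exponent ((ZMod m)ˣ ⧸ H)) :=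
      ⟨ne_zero_of_dvd_ne_zero Nat.card_pos.ne' Group.exponent_dvd_nat_card⟩
    obtain ⟨φ, hφ⟩ := CommGroup.exists_apply_ne_one_of_hasEnoughRootsOfUnity
      ((ZMod m)ˣ ⧸ H) ℂ hne
    let χ : DirichletCharacter ℂ m := MulChar.ofUnitHom (φ.comp (QuotientGroup.mk' H))
    have hχ (w : (ZMod m)ˣ) : χ w = (φ (w : (ZMod m)ˣ ⧸ H) : ℂ) := by
      simp [χ]
    have hH {w : (ZMod m)ˣ} (hw : w ∈ H) : χ w = 1 := by
      rw [hχ, (QuotientGroup.eq_one_iff w).mpr hw, map_one, Units.val_one]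
    have hχu := h χ (hH (Subgroup.subset_closure (by simp))) (by
      simpa [DirichletCharacter.Even] using
        hH (w := -1) (Subgroup.subset_closure (by simp)))
    rw [hχ] at hχu
    exact hφ (Units.ext hχu)
  obtain ⟨s, t, hst⟩ := Subgroup.mem_closure_pair.mp hu
  obtain ⟨i, hi⟩ : v ^ s ∈ Submonoid.powers v := by
    rw [mem_powers_iff_mem_zpowers]
    exact ⟨s, rfl⟩
  simp only at hi
  rw [← hi] at hst
  rcases Int.even_or_odd t with ht | ht
  · left
    refine ⟨i, ?_⟩
    rw [← hst, ht.neg_one_zpow, mul_one, Units.val_pow_eq_pow_val]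
  · right
    refine ⟨i, ?_⟩
    rw [← hst, ht.neg_one_zpow]
    simp

lemma prod_pow_pow_add_sub_one {A : Type*} [CommRing A] {x : A} {m r k : ℕ} (hx : x ^ m = 1)
    (hrk : r ^ (k + 1) ≡ 1 [MOD m]) (j : ℕ) :
    ∏ i ∈ Finset.range (k + 1), (x ^ r ^ (i + j) - 1) =
      ∏ i ∈ Finset.range (k + 1), (x ^ r ^ i - 1) := by
  induction j with
  | zero => rfl
  | succ j ih =>
    rw [← ih, Finset.prod_range_succ, Finset.prod_range_succ' _ k]
    congr 1
    · exact Finset.prod_congr rfl fun i _ ↦ by rw [add_right_comm, add_assoc]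
    · rw [show k + (j + 1) = (k + 1) + j by ring, zero_add, pow_add]
      congr 1
      refine pow_eq_pow_of_modEq ?_ hx
      simpa using hrk.mul_right (r ^ j)

lemma prod_pow_mul_pow_sub_one_of_modEq {A : Type*} [CommRing A] {x : A} {m a r k j : ℕ}
    (hx : x ^ m = 1) (hrk : r ^ (k + 1) ≡ 1 [MOD m]) (ha : a ≡ r ^ j [MOD m]) :
    ∏ i ∈ Finset.range (k + 1), (x ^ (a * r ^ i) - 1) =
      ∏ i ∈ Finset.range (k + 1), (x ^ r ^ i - 1) := by
  rw [← prod_pow_pow_add_sub_one hx hrk j]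
  refine Finset.prod_congr rfl fun i _ ↦ ?_
  congr 1
  refine pow_eq_pow_of_modEq ?_ hx
  rw [add_comm i j, pow_add]
  exact ha.mul_right _

lemma prod_pow_mul_pow_sub_one_of_add_modEq_zero {A : Type*} [CommRing A] {x : A}
    {m a r k j : ℕ} (hx : x ^ m = 1) (hrk : r ^ (k + 1) ≡ 1 [MOD m])
    (ha : a + r ^ j ≡ 0 [MOD m]) :
    ∏ i ∈ Finset.range (k + 1), (x ^ (a * r ^ i) - 1) =
      (-1) ^ (k + 1) * x ^ (a * ∑ i ∈ Finset.range (k + 1), r ^ i) *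
        ∏ i ∈ Finset.range (k + 1), (x ^ r ^ i - 1) := by
  have hterm (i : ℕ) :
      x ^ (a * r ^ i) - 1 = -1 * x ^ (a * r ^ i) * (x ^ r ^ (i + j) - 1) := by
    have : x ^ (a * r ^ i) * x ^ r ^ (i + j) = 1 := by
      rw [← pow_add, add_comm i j, pow_add r, ← add_mul, ← pow_zero x]
      refine pow_eq_pow_of_modEq ?_ hx
      simpa using ha.mul_right (r ^ i)
    linear_combination this
  rw [← prod_pow_pow_add_sub_one hx hrk j, Finset.prod_congr rfl fun i _ ↦ hterm i,
    Finset.prod_mul_distrib, Finset.prod_mul_distrib, Finset.prod_const, Finset.card_range,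
    Finset.prod_pow_eq_pow_sum, Finset.mul_sum]

lemma prod_pow_eq_prod_pow_of_geom_sum_dvd {a r n m : ℕ}
    (h : (∑ i ∈ Finset.range m, (X : ℤ[X]) ^ i) ∣
      (∏ i ∈ Finset.range n, ((X : ℤ[X]) ^ (a * r ^ i) - 1)
        - ∏ i ∈ Finset.range n, ((X : ℤ[X]) ^ (r ^ i) - 1)))
    {z : ℂ} (hz : z ^ m = 1) (hz1 : z ≠ 1) :
    ∏ i ∈ Finset.range n, (z ^ (a * r ^ i) - 1) = ∏ i ∈ Finset.range n, (z ^ r ^ i - 1) := by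
  have hgeom : ∑ i ∈ Finset.range m, z ^ i = 0 := by
    have := geom_sum_mul z m
    rw [hz, sub_self] at this
    exact (mul_eq_zero.mp this).resolve_right (sub_ne_zero.mpr hz1)
  have := map_dvd (aeval z) h
  simp only [map_sub, map_prod, map_sum, map_pow, aeval_X, map_one, hgeom, zero_dvd_iff] at this
  exact sub_eq_zero.mp this

lemma geom_sum_dvd_of_forall_prod_eq {a r n m : ℕ}
    (h : ∀ x : AdjoinRoot (∑ i ∈ Finset.range m, (X : ℤ[X]) ^ i), x ^ m = 1 →
      ∏ i ∈ Finset.range n, (x ^ (a * r ^ i) - 1) = ∏ i ∈ Finset.range n, (x ^ r ^ i - 1)) :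
    (∑ i ∈ Finset.range m, (X : ℤ[X]) ^ i) ∣
      (∏ i ∈ Finset.range n, ((X : ℤ[X]) ^ (a * r ^ i) - 1)
        - ∏ i ∈ Finset.range n, ((X : ℤ[X]) ^ (r ^ i) - 1)) := by
  rw [← AdjoinRoot.mk_eq_zero]
  simp only [map_sub, map_prod, map_pow, map_one]
  rw [sub_eq_zero]
  refine h _ ?_
  rw [← sub_eq_zero, ← map_pow, ← map_one (AdjoinRoot.mk _), ← map_sub, AdjoinRoot.mk_eq_zero]
  exact Dvd.intro _ (geom_sum_mul X m)

lemma odd_and_dvd_sum_of_prod_eq {a r k m : ℕ} (hm : 2 < m) (ham : Nat.Coprime a m)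
    (hrm : Nat.Coprime r m) (hrk : r ^ (k + 1) ≡ 1 [MOD m]) {j : ℕ}
    (ha : a + r ^ j ≡ 0 [MOD m])
    (h : ∀ z : ℂ, z ^ m = 1 → z ≠ 1 →
      ∏ i ∈ Finset.range (k + 1), (z ^ (a * r ^ i) - 1) =
        ∏ i ∈ Finset.range (k + 1), (z ^ r ^ i - 1)) :
    Odd k ∧ m ∣ ∑ i ∈ Finset.range (k + 1), r ^ i := by
  have hζ := Complex.isPrimitiveRoot_exp m (by omega)
  set ζ := Complex.exp (2 * Real.pi * Complex.I / m)
  set σ := ∑ i ∈ Finset.range (k + 1), r ^ i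
  have key (t : ℕ) (ht : ¬ m ∣ t) : (-1) ^ (k + 1) * (ζ ^ t) ^ (a * σ) = 1 := by
    have hz : (ζ ^ t) ^ m = 1 := by rw [← pow_mul, mul_comm, pow_mul, hζ.pow_eq_one, one_pow]
    have hz1 : ζ ^ t ≠ 1 := fun h1 ↦ ht ((hζ.pow_eq_one_iff_dvd t).mp h1)
    have hne : ∏ i ∈ Finset.range (k + 1), ((ζ ^ t) ^ r ^ i - 1) ≠ 0 := by
      refine Finset.prod_ne_zero_iff.mpr fun i _ h0 ↦ ht ?_
      rw [sub_eq_zero, ← pow_mul, hζ.pow_eq_one_iff_dvd] at h0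
      exact (hrm.symm.pow_right i).dvd_of_dvd_mul_right h0
    have heq := h _ hz hz1
    rw [prod_pow_mul_pow_sub_one_of_add_modEq_zero hz hrk ha] at heq
    exact mul_right_cancel₀ hne (heq.trans (one_mul _).symm)
  have k1 := key 1 (Nat.not_dvd_of_pos_of_lt one_pos (by omega))
  have k2 := key 2 (Nat.not_dvd_of_pos_of_lt two_pos hm)
  rw [pow_one] at k1
  rw [← pow_mul, mul_comm 2, pow_mul] at k2
  have h1 : ζ ^ (a * σ) = 1 := by
    linear_combination k2 - ζ ^ (a * σ) * k1
  have hpar : (-1 : ℂ) ^ (k + 1) = 1 := by rwa [h1, mul_one] at k1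
  have heven : Even (k + 1) := by
    rwa [neg_one_pow_eq_one_iff_even (by norm_num)] at hpar
  refine ⟨by rw [← Nat.not_even_iff_odd]; exact Nat.even_add_one.mp heven, ?_⟩
  exact ham.symm.dvd_of_dvd_mul_left ((hζ.pow_eq_one_iff_dvd _).mp h1)

theorem stmt_15 (a r k m : ℕ) (ha : 0 < a) (hr : 0 < r) (hk : 0 < k) (hm : 0 < m)
    (ham : Nat.Coprime a m) (hrm : Nat.Coprime r m)
    (hak : a ^ (k + 1) ≡ 1 [MOD m]) (hrk : r ^ (k + 1) ≡ 1 [MOD m])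
    (hr1 : ¬ r ≡ 1 [MOD m]) :
    (∑ i ∈ Finset.range m, (X : ℤ[X]) ^ i) ∣
        (∏ i ∈ Finset.range (k + 1), ((X : ℤ[X]) ^ (a * r ^ i) - 1)
          - ∏ i ∈ Finset.range (k + 1), ((X : ℤ[X]) ^ (r ^ i) - 1)) ↔
      ((∃ i : ℕ, (a : ZMod m) = (r : ZMod m) ^ i) ∨
        ((∃ i : ℕ, -(a : ZMod m) = (r : ZMod m) ^ i) ∧ Odd k ∧
          m ∣ ∑ i ∈ Finset.range (k + 1), r ^ i)) := by
  have : NeZero m := ⟨hm.ne'⟩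
  have hm2 : 2 < m := by
    by_contra! hle
    interval_cases m
    · exact hr1 (Nat.modEq_one)
    · exact hr1 (Nat.odd_iff.mp (Nat.coprime_two_right.mp hrm))
  have hneg {j : ℕ} (hj : -(a : ZMod m) = (r : ZMod m) ^ j) : a + r ^ j ≡ 0 [MOD m] := by
    rw [← ZMod.natCast_eq_natCast_iff]
    push_cast
    rw [← hj, add_neg_cancel]
  constructor
  · intro h
    have hz : ∀ z : ℂ, z ^ m = 1 → z ≠ 1 →
        ∏ i ∈ Finset.range (k + 1), (z ^ (a * r ^ i) - 1) =
          ∏ i ∈ Finset.range (k + 1), (z ^ r ^ i - 1) :=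
      fun z h1 h2 ↦ prod_pow_eq_prod_pow_of_geom_sum_dvd h h1 h2
    rcases ZMod.exists_eq_pow_or_neg_eq_pow ((ZMod.isUnit_iff_coprime a m).mpr ham)
      ((ZMod.isUnit_iff_coprime r m).mpr hrm) (fun χ hχr hχe ↦
        dirichletCharacter_apply_eq_one_of_prod_eq k.succ_ne_zero ham hrm hz hχr hχe) with
      hi | ⟨j, hj⟩
    · exact Or.inl hi
    · exact Or.inr ⟨⟨j, hj⟩, odd_and_dvd_sum_of_prod_eq hm2 ham hrm hrk (hneg hj) hz⟩
  · rintro (⟨j, hj⟩ | ⟨⟨j, hj⟩, hodd, hdvd⟩)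
    · refine geom_sum_dvd_of_forall_prod_eq fun x hx ↦
        prod_pow_mul_pow_sub_one_of_modEq (j := j) hx hrk ?_
      rw [← ZMod.natCast_eq_natCast_iff]
      exact_mod_cast hj
    · refine geom_sum_dvd_of_forall_prod_eq fun x hx ↦ ?_
      obtain ⟨c, hc⟩ := hdvd
      rw [prod_pow_mul_pow_sub_one_of_add_modEq_zero hx hrk (hneg hj),
        hodd.add_one.neg_one_pow, hc, mul_left_comm, pow_mul, hx, one_pow, one_mul, one_mul]
end

section
/- Let a, b, k, d be positive integers with a, b ≥ 2, k ≥ 1, gcd(a,b) = 1, and d dividing a. For 1 ≤ i ≤ k set g_i = a^{k−i} b^i. Then, as an equality of integers, 2·(b − a)·d · ∑_{(n₁,…,n_k)} (n₁g₁ + ⋯ + n_k g_k) = a^k · ( b^k·(a·b − a + a·d − b·d) − a^k·(a − 1)·b ), where the sum ranges over all tuples (n₁,…,n_k) with 0 ≤ n_i ≤ a − 1 for each i such that d divides n₁g₁ + ⋯ + n_k g_k. (Here the computation is carried out in ℤ, allowing b − a to be negative.) -/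
theorem sum_range_mul_ite_dvd {d : ℕ} (hd : 0 < d) (q : ℕ) (f : ℕ → ℤ) :
    ∑ x ∈ Finset.range (d * q), (if d ∣ x then f x else 0) =
      ∑ j ∈ Finset.range q, f (d * j) := by
  induction q with
  | zero => simp
  | succ q ih =>
    rw [Nat.mul_succ, Finset.sum_range_add, ih, Finset.sum_range_succ]
    congr 1
    rw [Finset.sum_eq_single_of_mem 0 (Finset.mem_range.2 hd)]
    · simp
    · intro i hi hi0
      rw [if_neg]
      rw [Nat.dvd_add_right (dvd_mul_right d q)]
      exact Nat.not_dvd_of_pos_of_lt (Nat.pos_of_ne_zero hi0) (Finset.mem_range.1 hi)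

theorem two_mul_sum_range_cast (q : ℕ) :
    2 * ∑ j ∈ Finset.range q, (j : ℤ) = q * (q - 1) := by
  induction q with
  | zero => simp
  | succ q ih =>
    rw [Finset.sum_range_succ, mul_add, ih]
    push_cast
    ring

theorem sum_pi_fin_succ {m a : ℕ} (F : (Fin (m + 1) → Fin a) → ℤ) :
    ∑ n, F n = ∑ x : Fin a, ∑ n : Fin m → Fin a, F (Fin.snoc n x) := by
  rw [← (Fin.snocEquiv (fun _ : Fin (m + 1) => Fin a)).sum_comp F, Fintype.sum_prod_type]
  rfl

theorem two_mul_sum_pi_linear (a m : ℕ) (g : Fin m → ℤ) :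
    2 * ∑ n : Fin m → Fin a, ∑ i, ((n i : ℕ) : ℤ) * g i =
      (a : ℤ) ^ m * (a - 1) * ∑ i, g i := by
  induction m with
  | zero => simp
  | succ m ih =>
    have h := two_mul_sum_range_cast a
    rw [← Fin.sum_univ_eq_sum_range (fun j => (j : ℤ))] at h
    rw [sum_pi_fin_succ]
    simp only [Fin.sum_univ_castSucc, Fin.snoc_castSucc, Fin.snoc_last, Finset.sum_add_distrib,
      Finset.sum_const, Finset.card_univ, Fintype.card_fin, Fintype.card_fun, nsmul_eq_mul,
      ← Finset.mul_sum, ← Finset.sum_mul]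
    push_cast
    linear_combination (a : ℤ) * ih (fun i => g i.castSucc) + (a : ℤ) ^ m * g (Fin.last m) * h

theorem sub_mul_sum_pow_mul_pow (a b : ℤ) (m : ℕ) :
    (b - a) * ∑ i : Fin m, a ^ (m - i.val) * b ^ (i.val + 1) =
      a * b ^ (m + 1) - a ^ (m + 1) * b := by
  rw [Fin.sum_univ_eq_sum_range (fun i => a ^ (m - i) * b ^ (i + 1))]
  have h : ∑ i ∈ Finset.range m, a ^ (m - i) * b ^ (i + 1) =
      a * b * ∑ i ∈ Finset.range m, b ^ i * a ^ (m - 1 - i) := by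
    rw [Finset.mul_sum]
    refine Finset.sum_congr rfl fun i hi => ?_
    have hi' := Finset.mem_range.1 hi
    rw [show m - i = (m - 1 - i) + 1 by omega]
    ring
  rw [h]
  linear_combination a * b * geom_sum₂_mul b a m

theorem dvd_sum_snoc_iff {a b d m : ℕ} (hab : Nat.Coprime a b) (hda : d ∣ a)
    (n : Fin m → Fin a) (x : Fin a) :
    d ∣ ∑ i : Fin m, (n i : ℕ) * (a ^ (m - i.val) * b ^ (i.val + 1)) + (x : ℕ) * b ^ (m + 1) ↔
      d ∣ (x : ℕ) := by
  rw [Nat.dvd_add_right]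
  · exact ((hab.coprime_dvd_left hda).pow_right (m + 1)).dvd_mul_right
  · refine Finset.dvd_sum fun i _ => Dvd.dvd.mul_left (Dvd.dvd.mul_right ?_ _) _
    exact dvd_pow hda (by omega)

theorem stmt_17 (a b k d : ℕ) (ha : 2 ≤ a) (hb : 2 ≤ b) (hk : 1 ≤ k)
    (hab : Nat.Coprime a b) (hd : 0 < d) (hda : d ∣ a) :
    2 * ((b : ℤ) - (a : ℤ)) * (d : ℤ) *
        ∑ n ∈ Finset.univ.filter (fun n : Fin k → Fin a =>
            d ∣ ∑ i : Fin k, (n i : ℕ) * (a ^ (k - (i.val + 1)) * b ^ (i.val + 1))),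
          ((∑ i : Fin k, (n i : ℕ) * (a ^ (k - (i.val + 1)) * b ^ (i.val + 1)) : ℕ) : ℤ) =
      (a : ℤ) ^ k *
        ((b : ℤ) ^ k * ((a : ℤ) * b - a + (a : ℤ) * d - (b : ℤ) * d)
          - (a : ℤ) ^ k * ((a : ℤ) - 1) * b) := by
  obtain ⟨m, rfl⟩ : ∃ m, k = m + 1 := ⟨k - 1, by omega⟩
  obtain ⟨q, hq⟩ := id hda
  rw [Finset.sum_filter, sum_pi_fin_succ]
  simp only [Fin.sum_univ_castSucc, Fin.snoc_castSucc, Fin.snoc_last, Fin.val_castSucc,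
    Fin.val_last, Nat.add_sub_add_right, Nat.sub_self, pow_zero, one_mul,
    dvd_sum_snoc_iff hab hda]
  have hT := two_mul_sum_pi_linear a m (fun i => (a : ℤ) ^ (m - i.val) * (b : ℤ) ^ (i.val + 1))
  have hG := sub_mul_sum_pow_mul_pow (a : ℤ) b m
  set G := ∑ i : Fin m, (a : ℤ) ^ (m - i.val) * (b : ℤ) ^ (i.val + 1)
  set T := ∑ n : Fin m → Fin a, ∑ i : Fin m,
    ((n i : ℕ) : ℤ) * ((a : ℤ) ^ (m - i.val) * (b : ℤ) ^ (i.val + 1)) with hTdef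
  have inner (x : Fin a) : (∑ n : Fin m → Fin a, if d ∣ (x : ℕ) then
      ((∑ i : Fin m, (n i : ℕ) * (a ^ (m - i.val) * b ^ (i.val + 1)) +
        (x : ℕ) * b ^ (m + 1) : ℕ) : ℤ) else 0) =
      (fun y : ℕ => if d ∣ y then T + (a : ℤ) ^ m * (y * (b : ℤ) ^ (m + 1)) else 0) x := by
    dsimp only
    split_ifs
    · push_cast
      simp [Finset.sum_add_distrib, hTdef]
    · simp
  clear_value T
  rw [Fintype.sum_congr _ _ inner, Fin.sum_univ_eq_sum_range
    (fun y : ℕ => if d ∣ y then T + (a : ℤ) ^ m * (y * (b : ℤ) ^ (m + 1)) else 0) a]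
  have hS : ∑ y ∈ Finset.range a,
      (if d ∣ y then T + (a : ℤ) ^ m * (y * (b : ℤ) ^ (m + 1)) else 0) =
      q * T + (a : ℤ) ^ m * (b : ℤ) ^ (m + 1) * d * ∑ j ∈ Finset.range q, (j : ℤ) := by
    conv_lhs => rw [hq]
    rw [sum_range_mul_ite_dvd hd q
      (fun y => T + ((d * q : ℕ) : ℤ) ^ m * (y * (b : ℤ) ^ (m + 1))), ← hq,
      Finset.sum_add_distrib, Finset.mul_sum]
    simp only [Finset.sum_const, Finset.card_range, nsmul_eq_mul]
    congr 1
    refine Finset.sum_congr rfl fun j _ => ?_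
    push_cast
    ring
  rw [hS]
  have hJ := two_mul_sum_range_cast q
  have hqz : (a : ℤ) = d * q := by exact_mod_cast hq
  set J := ∑ j ∈ Finset.range q, (j : ℤ)
  have hdJ : 2 * ((d : ℤ) * d * J) = a * (a - d) := by
    rw [hqz]
    linear_combination (d : ℤ) * d * hJ
  calc 2 * ((b : ℤ) - a) * d * (q * T + (a : ℤ) ^ m * (b : ℤ) ^ (m + 1) * d * J)
      = (b - a) * ((d * q) * (2 * T) + (a : ℤ) ^ m * (b : ℤ) ^ (m + 1) * (2 * (d * d * J))) := by
        ring
    _ = _ := by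
        rw [← hqz, hT, hdJ]
        linear_combination (a : ℤ) ^ (m + 1) * (a - 1) * hG
end
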